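/- arXiv:1010.4820 — 2 statements merged into one kernel-verified Lean document; each statement's English description precedes it below -/
import Mathlib

section
/- Under the drift condition (V3), every probability measure π on X that is invariant for P satisfies ∫ f dπ ≤ b_f. -/
open MeasureTheory ProbabilityTheory ENNReal

/-- A set-wise invariant measure integrates `g` and its image under the kernel equally. -/
lemma lintegral_lintegral_eq_of_invariant {X : Type*} [MeasurableSpace X]
    (P : Kernel X X) (π : Measure X)
    (hπ : ∀ A : Set X, MeasurableSet A → ∫⁻ x, P x A ∂π = π A)
    {g : X → ℝ≥0∞} (hg : Measurable g) :
    ∫⁻ x, ∫⁻ y, g y ∂(P x) ∂π = ∫⁻ x, g x ∂π := by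
  have hbind : π.bind P = π := by
    ext A hA
    rw [Measure.bind_apply hA P.measurable.aemeasurable, hπ A hA]
  conv_rhs => rw [← hbind]
  rw [Measure.lintegral_bind P.measurable.aemeasurable hg.aemeasurable]

/-- Truncating `V` at level `n` preserves the drift inequality, with `f` restricted to the
sublevel set `{V ≤ n}`. -/
lemma lintegral_min_add_indicator_le {X : Type*} [MeasurableSpace X]
    (P : Kernel X X) [IsMarkovKernel P] {V f : X → ℝ≥0∞} {b : ℝ≥0∞}
    (hdrift : ∀ x, (∫⁻ y, V y ∂(P x)) + f x ≤ V x + b) (n : ℝ≥0∞) (x : X) :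
    (∫⁻ y, min (V y) n ∂(P x)) + {x | V x ≤ n}.indicator f x ≤ min (V x) n + b := by
  by_cases hx : V x ≤ n
  · rw [Set.indicator_of_mem (show x ∈ {x | V x ≤ n} from hx), min_eq_left hx]
    refine le_trans ?_ (hdrift x)
    gcongr
    exact min_le_left _ _
  · rw [Set.indicator_of_notMem (show x ∉ {x | V x ≤ n} from hx),
      min_eq_right (not_le.mp hx).le, add_zero]
    calc ∫⁻ y, min (V y) n ∂(P x) ≤ ∫⁻ _, n ∂(P x) := lintegral_mono fun y => min_le_right _ _
      _ = n := by simp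
      _ ≤ n + b := le_self_add

/-- Under drift condition (V3), every invariant probability measure `π`
of the Markov kernel `P` satisfies `∫ f dπ ≤ b_f`. -/
theorem stmt_4 {X : Type*} [MeasurableSpace X]
    (P : ProbabilityTheory.Kernel X X) [IsMarkovKernel P]
    (V f : X → ℝ≥0∞) (hVmeas : Measurable V) (hfmeas : Measurable f)
    (hVfin : ∀ x, V x ≠ ∞) (hffin : ∀ x, f x ≠ ∞)
    (C : Set X) (hC : MeasurableSet C) (bf : ℝ≥0∞) (hbf : bf ≠ ∞)
    (hdrift : ∀ x, (∫⁻ y, V y ∂(P x)) + f x ≤ V x + bf * C.indicator 1 x) :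
    ∀ π : Measure X, IsProbabilityMeasure π →
      (∀ A : Set X, MeasurableSet A → ∫⁻ x, P x A ∂π = π A) →
      ∫⁻ x, f x ∂π ≤ bf := by
  intro π _ hinv
  have hdrift' : ∀ x, (∫⁻ y, V y ∂(P x)) + f x ≤ V x + bf := fun x =>
    (hdrift x).trans <| by
      gcongr
      exact mul_le_of_le_one_right' (Set.indicator_le_self' (by simp) x)
  have hmeas (n : ℕ) : Measurable ({x | V x ≤ n}.indicator f) :=
    hfmeas.indicator (measurableSet_le hVmeas measurable_const)
  have hbound (n : ℕ) : ∫⁻ x, {x | V x ≤ n}.indicator f x ∂π ≤ bf := by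
    have hmin : Measurable fun x => min (V x) (n : ℝ≥0∞) := hVmeas.min measurable_const
    have hfin : ∫⁻ x, min (V x) (n : ℝ≥0∞) ∂π ≠ ∞ := by
      refine ne_top_of_le_ne_top (natCast_ne_top n) ?_
      calc ∫⁻ x, min (V x) (n : ℝ≥0∞) ∂π ≤ ∫⁻ _, (n : ℝ≥0∞) ∂π :=
            lintegral_mono fun x => min_le_right _ _
        _ = n := by simp
    refine (ENNReal.add_le_add_iff_left hfin).mp ?_
    calc ∫⁻ x, min (V x) (n : ℝ≥0∞) ∂π + ∫⁻ x, {x | V x ≤ n}.indicator f x ∂π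
        = ∫⁻ x, ((∫⁻ y, min (V y) (n : ℝ≥0∞) ∂(P x)) + {x | V x ≤ n}.indicator f x) ∂π := by
          rw [lintegral_add_right _ (hmeas n), lintegral_lintegral_eq_of_invariant P π hinv hmin]
      _ ≤ ∫⁻ x, (min (V x) (n : ℝ≥0∞) + bf) ∂π :=
          lintegral_mono (lintegral_min_add_indicator_le P hdrift' n)
      _ = ∫⁻ x, min (V x) (n : ℝ≥0∞) ∂π + bf := by
          rw [lintegral_add_left hmin]
          simp
  have hsup : ∀ x, f x ≤ ⨆ n : ℕ, {x | V x ≤ n}.indicator f x := fun x => by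
    obtain ⟨n, hn⟩ := ENNReal.exists_nat_gt (hVfin x)
    refine le_iSup_of_le n ?_
    rw [Set.indicator_of_mem (show x ∈ {x | V x ≤ n} from hn.le)]
  have hmono : Monotone fun (n : ℕ) => {x | V x ≤ n}.indicator f := fun m n hmn =>
    Set.indicator_le_indicator_of_subset
      (fun x (hx : V x ≤ m) => hx.trans (Nat.cast_le.mpr hmn)) fun _ => zero_le
  calc ∫⁻ x, f x ∂π ≤ ∫⁻ x, ⨆ n : ℕ, {x | V x ≤ n}.indicator f x ∂π := lintegral_mono hsup
    _ = ⨆ n : ℕ, ∫⁻ x, {x | V x ≤ n}.indicator f x ∂π := lintegral_iSup hmeas hmono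
    _ ≤ bf := iSup_le hbound
end

section
/- Assume additionally that α·(|a|+δ)^{(1/p)−1} < 1, and that à := −log₂(α)/s and B̃ := log₂(|a|+δ)/s are positive integers that are relatively prime. Then the Markov kernel P of the pair process (x_t, Δ_t) on ℝ × D admits a unique invariant probability measure. -/
open MeasureTheory ProbabilityTheory ENNReal

/-- The uniform quantizer `Q_K^Δ` with `K` bins of size `Δ` in the granular region
`[-(K/2)Δ, (K/2)Δ]` (here `2^{R'-1} = K/2`). -/
noncomputable def Qq (K : ℕ) (Δ x : ℝ) : ℝ :=
  if x = (K : ℝ) / 2 * Δ then ((K : ℝ) - 1) / 2 * Δ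
  else if |x| ≤ (K : ℝ) / 2 * Δ then
    ((⌊x / Δ + (K : ℝ) / 2⌋ : ℝ) + 1 - ((K : ℝ) + 1) / 2) * Δ
  else 0

/-- The adaptive-quantizer zoom factor `H(Δ, h, υ)`. -/
noncomputable def Hf (a δ α L Δ h : ℝ) (υ : Bool) : ℝ :=
  if 1 < |h| ∨ υ = false then |a| + δ
  else if L ≤ Δ then α else 1

/-- The countable set of admissible bin sizes:
`D = {Δ ≥ L' = αL : log₂ Δ is an integer multiple of s}`. -/
def Dset (α L s : ℝ) : Set ℝ :=
  {Δ : ℝ | α * L ≤ Δ ∧ ∃ z : ℤ, Real.logb 2 Δ = (z : ℝ) * s}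


/-- The action `f ↦ Q f` of a kernel on nonnegative functions. -/
noncomputable def kernelOp {E : Type*} [MeasurableSpace E] (Q : Kernel E E) (f : E → ℝ≥0∞) :
    E → ℝ≥0∞ := fun z => ∫⁻ w, f w ∂(Q z)

section KernelOp

variable {E : Type*} [MeasurableSpace E] (Q : Kernel E E)

lemma measurable_kernelOp_iterate {f : E → ℝ≥0∞} (hf : Measurable f) (n : ℕ) :
    Measurable ((kernelOp Q)^[n] f) := by
  induction n with
  | zero => exact hf
  | succ n ih =>
    rw [Function.iterate_succ_apply']
    exact ih.lintegral_kernel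

lemma measurable_kernelOp {f : E → ℝ≥0∞} (hf : Measurable f) : Measurable (kernelOp Q f) :=
  measurable_kernelOp_iterate Q hf 1

lemma kernelOp_mono {f g : E → ℝ≥0∞} (h : f ≤ g) : kernelOp Q f ≤ kernelOp Q g :=
  fun _ => lintegral_mono h

lemma kernelOp_iterate_mono {f g : E → ℝ≥0∞} (h : f ≤ g) (n : ℕ) :
    (kernelOp Q)^[n] f ≤ (kernelOp Q)^[n] g := by
  induction n with
  | zero => exact h
  | succ n ih =>
    rw [Function.iterate_succ_apply', Function.iterate_succ_apply']
    exact kernelOp_mono Q ih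

lemma kernelOp_iterate_add {f g : E → ℝ≥0∞} (hf : Measurable f) (n : ℕ) :
    (kernelOp Q)^[n] (f + g) = (kernelOp Q)^[n] f + (kernelOp Q)^[n] g := by
  induction n with
  | zero => rfl
  | succ n ih =>
    rw [Function.iterate_succ_apply', Function.iterate_succ_apply', Function.iterate_succ_apply',
      ih]
    funext z
    exact lintegral_add_left (measurable_kernelOp_iterate Q hf n) _

lemma kernelOp_sum_iterate {f : E → ℝ≥0∞} (hf : Measurable f) (m : ℕ) (z : E) :
    kernelOp Q (fun w => ∑ n ∈ Finset.range m, (kernelOp Q)^[n] f w) z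
      = ∑ n ∈ Finset.range m, (kernelOp Q)^[n + 1] f z := by
  simp only [Function.iterate_succ_apply', kernelOp]
  exact lintegral_finsetSum _ fun n _ => measurable_kernelOp_iterate Q hf n

/-- The potential `∑ₙ Qⁿ f`. -/
noncomputable def potential (f : E → ℝ≥0∞) (z : E) : ℝ≥0∞ := ∑' n, (kernelOp Q)^[n] f z

lemma potential_mono {f g : E → ℝ≥0∞} (h : f ≤ g) (z : E) : potential Q f z ≤ potential Q g z :=
  ENNReal.tsum_le_tsum fun n => kernelOp_iterate_mono Q h n z

lemma potential_add {f g : E → ℝ≥0∞} (hf : Measurable f) (z : E) :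
    potential Q (f + g) z = potential Q f z + potential Q g z := by
  simp only [potential, kernelOp_iterate_add Q hf, Pi.add_apply]
  exact ENNReal.tsum_add

lemma potential_kernelOp_le (f : E → ℝ≥0∞) (z : E) :
    potential Q (kernelOp Q f) z ≤ potential Q f z := by
  have h : ∑' n, (kernelOp Q)^[n] f z
      = (kernelOp Q)^[0] f z + ∑' n, (kernelOp Q)^[n + 1] f z :=
    tsum_eq_zero_add' ENNReal.summable
  rw [potential, potential, h]
  simp only [Function.iterate_succ_apply]
  exact le_add_self

lemma potential_const_mul {f : E → ℝ≥0∞} (hf : Measurable f) (c : ℝ≥0∞) (z : E) :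
    potential Q (fun w => c * f w) z = c * potential Q f z := by
  have h : ∀ n, (kernelOp Q)^[n] (fun w => c * f w) = fun w => c * (kernelOp Q)^[n] f w := by
    intro n
    induction n with
    | zero => rfl
    | succ n ih =>
      rw [Function.iterate_succ_apply', ih, Function.iterate_succ_apply']
      funext w
      exact lintegral_const_mul c (measurable_kernelOp_iterate Q hf n)
  simp only [potential, h]
  exact ENNReal.tsum_mul_left

lemma potential_zero (z : E) : potential Q 0 z = 0 := by
  have h : ∀ n, (kernelOp Q)^[n] (0 : E → ℝ≥0∞) = 0 := by
    intro n
    refine Function.iterate_fixed ?_ n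
    funext w
    simp [kernelOp]
  simp [potential, h]

lemma potential_sum {ι : Type*} (s : Finset ι) (f : ι → E → ℝ≥0∞) (hf : ∀ i, Measurable (f i))
    (z : E) :
    potential Q (fun w => ∑ i ∈ s, f i w) z = ∑ i ∈ s, potential Q (f i) z := by
  classical
  induction s using Finset.induction_on with
  | empty => exact potential_zero Q z
  | insert i s hi ih =>
    simp only [Finset.sum_insert hi]
    rw [← ih]
    exact potential_add Q (hf i) z

/-- Maximum principle: a drift inequality bounds the potential. -/
lemma potential_le_of_drift {V f F : E → ℝ≥0∞} (hf : Measurable f) (hV : Measurable V)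
    (h : ∀ z, kernelOp Q V z + f z ≤ V z + F z) (hF : Measurable F) (z : E) :
    potential Q f z ≤ V z + potential Q F z := by
  have key : ∀ m z, ∑ n ∈ Finset.range m, (kernelOp Q)^[n] f z + (kernelOp Q)^[m] V z
      ≤ V z + ∑ n ∈ Finset.range m, (kernelOp Q)^[n] F z := by
    intro m
    induction m with
    | zero => simp
    | succ m ih =>
      intro z
      have h1 : kernelOp Q (fun w => ∑ n ∈ Finset.range m, (kernelOp Q)^[n] f w
          + (kernelOp Q)^[m] V w) z ≤ kernelOp Q (fun w => V w
          + ∑ n ∈ Finset.range m, (kernelOp Q)^[n] F w) z := kernelOp_mono Q ih z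
      have h2 : kernelOp Q (fun w => ∑ n ∈ Finset.range m, (kernelOp Q)^[n] f w
          + (kernelOp Q)^[m] V w) z = ∑ n ∈ Finset.range m, (kernelOp Q)^[n + 1] f z
          + (kernelOp Q)^[m + 1] V z := by
        rw [← kernelOp_sum_iterate Q hf, Function.iterate_succ_apply']
        exact lintegral_add_right _ (measurable_kernelOp_iterate Q hV m)
      have h3 : kernelOp Q (fun w => V w + ∑ n ∈ Finset.range m, (kernelOp Q)^[n] F w) z
          = kernelOp Q V z + ∑ n ∈ Finset.range m, (kernelOp Q)^[n + 1] F z := by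
        rw [← kernelOp_sum_iterate Q hF]
        exact lintegral_add_left hV _
      rw [h2, h3] at h1
      rw [Finset.sum_range_succ' _ m, Finset.sum_range_succ' _ m]
      calc ∑ n ∈ Finset.range m, (kernelOp Q)^[n + 1] f z + (kernelOp Q)^[0] f z
            + (kernelOp Q)^[m + 1] V z
          = (∑ n ∈ Finset.range m, (kernelOp Q)^[n + 1] f z + (kernelOp Q)^[m + 1] V z) + f z := by
            rw [Function.iterate_zero_apply]; ring
        _ ≤ (kernelOp Q V z + ∑ n ∈ Finset.range m, (kernelOp Q)^[n + 1] F z) + f z := by gcongr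
        _ = (kernelOp Q V z + f z) + ∑ n ∈ Finset.range m, (kernelOp Q)^[n + 1] F z := by ring
        _ ≤ (V z + F z) + ∑ n ∈ Finset.range m, (kernelOp Q)^[n + 1] F z :=
            add_le_add_left (h z) _
        _ = _ := by rw [Function.iterate_zero_apply]; ring
  refine ENNReal.tsum_le_of_sum_range_le fun m => ?_
  calc ∑ n ∈ Finset.range m, (kernelOp Q)^[n] f z
      ≤ V z + ∑ n ∈ Finset.range m, (kernelOp Q)^[n] F z := le_self_add.trans (key m z)
    _ ≤ V z + potential Q F z := by
      gcongr
      exact ENNReal.sum_le_tsum _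

/-- The measure `∑ₙ ν Qⁿ`. -/
noncomputable def potentialMeasure (ν : Measure E) : Measure E :=
  Measure.sum fun n => (fun m : Measure E => m.bind Q)^[n] ν

lemma lintegral_bind_iterate {f : E → ℝ≥0∞} (hf : Measurable f) (n : ℕ) (ν : Measure E) :
    ∫⁻ z, f z ∂((fun m : Measure E => m.bind Q)^[n] ν) = ∫⁻ z, (kernelOp Q)^[n] f z ∂ν := by
  induction n generalizing ν with
  | zero => rfl
  | succ n ih =>
    rw [Function.iterate_succ_apply, ih, Function.iterate_succ_apply']
    exact Measure.lintegral_bind Q.measurable.aemeasurable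
      (measurable_kernelOp_iterate Q hf n).aemeasurable

lemma lintegral_potentialMeasure {f : E → ℝ≥0∞} (hf : Measurable f) (ν : Measure E) :
    ∫⁻ z, f z ∂(potentialMeasure Q ν) = ∑' n, ∫⁻ z, (kernelOp Q)^[n] f z ∂ν := by
  simp only [potentialMeasure, lintegral_sum_measure, lintegral_bind_iterate Q hf]

lemma lintegral_potentialMeasure_eq_add {f : E → ℝ≥0∞} (hf : Measurable f) (ν : Measure E) :
    ∫⁻ z, f z ∂(potentialMeasure Q ν)
      = ∫⁻ z, f z ∂ν + ∫⁻ z, kernelOp Q f z ∂(potentialMeasure Q ν) := by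
  rw [lintegral_potentialMeasure Q hf,
    lintegral_potentialMeasure Q (f := kernelOp Q f) hf.lintegral_kernel,
    tsum_eq_zero_add' ENNReal.summable]
  rfl

end KernelOp

/-- Regeneration criterion: if `P = Q + g ⊗ ν` and a drift condition towards the states from which
`g` is accessible holds, then `P` has a unique invariant probability measure. -/
theorem existsUnique_invariant_of_regeneration {E : Type*} [MeasurableSpace E]
    (P Q : Kernel E E) [IsMarkovKernel P] (ν : Measure E) [IsProbabilityMeasure ν]
    {g V : E → ℝ≥0∞} (hg : Measurable g) (hdec : ∀ z, P z = Q z + g z • ν)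
    (hV : Measurable V) (hVfin : ∀ z, V z ≠ ∞) (hνV : ∫⁻ z, V z ∂ν ≠ ∞)
    {b : ℝ≥0∞} (hb : b ≠ ∞) (N : ℕ)
    (hdrift : ∀ z, kernelOp P V z + 1 ≤
      V z + b * ∑ k ∈ Finset.range N, (kernelOp P)^[k] g z) :
    ∃! π : Measure E, IsProbabilityMeasure π ∧
      ∀ A : Set E, MeasurableSet A → ∫⁻ z, P z A ∂π = π A := by
  have hop : ∀ (f : E → ℝ≥0∞) z, kernelOp P f z = kernelOp Q f z + g z * ∫⁻ w, f w ∂ν := by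
    intro f z
    simp only [kernelOp, hdec, lintegral_add_measure, lintegral_smul_measure, smul_eq_mul]
  have hQP : ∀ (f : E → ℝ≥0∞) z, kernelOp Q f z ≤ kernelOp P f z := fun f z => by
    rw [hop]; exact le_self_add
  have hP1 : ∀ z, kernelOp P 1 z = 1 := fun z => by simp [kernelOp]
  have hQ1 : ∀ z, kernelOp Q 1 z + g z = 1 := fun z => by
    rw [← hP1 z, hop]; simp
  have hgpot : ∀ z, potential Q g z ≤ 1 := fun z => by
    simpa [potential_zero] using potential_le_of_drift Q (V := 1) (F := 0) hg measurable_one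
      (fun z => by simp [hQ1 z]) measurable_zero z
  have hPg1 : ∀ k z, (kernelOp P)^[k] g z ≤ 1 := by
    intro k
    induction k with
    | zero => intro z; rw [← hQ1 z]; exact le_add_self
    | succ k ih =>
      intro z
      rw [Function.iterate_succ_apply', ← hP1 z]
      exact kernelOp_mono P ih z
  have hPgpot : ∀ k z, potential Q ((kernelOp P)^[k] g) z ≤ k + 1 := by
    intro k
    induction k with
    | zero => simpa using hgpot
    | succ k ih =>
      intro z
      have hle : (kernelOp P)^[k + 1] g ≤ kernelOp Q ((kernelOp P)^[k] g) + g := by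
        intro w
        rw [Function.iterate_succ_apply', hop, Pi.add_apply]
        gcongr
        refine mul_le_of_le_one_right' ?_
        calc ∫⁻ w, (kernelOp P)^[k] g w ∂ν ≤ ∫⁻ _, 1 ∂ν := lintegral_mono (hPg1 k)
          _ = 1 := by simp
      refine (potential_mono Q hle z).trans ?_
      rw [potential_add Q (measurable_kernelOp Q (measurable_kernelOp_iterate P hg k))]
      push_cast
      exact add_le_add ((potential_kernelOp_le Q _ z).trans (ih z)) (hgpot z)
  have hFm : Measurable fun z => ∑ k ∈ Finset.range N, (kernelOp P)^[k] g z :=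
    Finset.measurable_fun_sum _ fun k _ => measurable_kernelOp_iterate P hg k
  set c : ℝ≥0∞ := b * ∑ k ∈ Finset.range N, ((k : ℝ≥0∞) + 1) with hc
  have hcfin : c ≠ ∞ := by
    refine ENNReal.mul_ne_top hb ?_
    rw [ENNReal.sum_ne_top]
    intro k _
    finiteness
  have hpot : ∀ z, potential Q 1 z ≤ V z + c := by
    intro z
    refine (potential_le_of_drift Q (V := V) measurable_one hV
      (fun z => (add_le_add_left (hQP V z) _).trans (hdrift z)) (hFm.const_mul b) z).trans ?_
    rw [potential_const_mul Q hFm, potential_sum Q _ _ fun k => measurable_kernelOp_iterate P hg k]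
    rw [hc]
    gcongr
    exact hPgpot _ z
  set μ := potentialMeasure Q ν with hμ
  have hμuniv : μ Set.univ ≠ ∞ := by
    have h1 : μ Set.univ = ∫⁻ z, potential Q 1 z ∂ν := by
      have := lintegral_potentialMeasure Q (f := 1) measurable_one ν
      simp only [Pi.one_apply, lintegral_one] at this
      rw [hμ, this]
      exact (lintegral_tsum fun n =>
        (measurable_kernelOp_iterate Q measurable_one n).aemeasurable).symm
    rw [h1]
    refine ne_top_of_le_ne_top ?_ (lintegral_mono hpot)
    rw [lintegral_add_right _ measurable_const]
    simp [hνV, hcfin]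
  have hμrec : ∀ {f : E → ℝ≥0∞}, Measurable f →
      ∫⁻ z, f z ∂μ = ∫⁻ z, f z ∂ν + ∫⁻ z, kernelOp Q f z ∂μ :=
    fun hf => lintegral_potentialMeasure_eq_add Q hf ν
  have hμP : ∀ {f : E → ℝ≥0∞}, Measurable f →
      ∫⁻ z, kernelOp P f z ∂μ = ∫⁻ z, kernelOp Q f z ∂μ + (∫⁻ z, g z ∂μ) * ∫⁻ z, f z ∂ν := by
    intro f hf
    simp only [hop]
    rw [lintegral_add_left (measurable_kernelOp Q hf), lintegral_mul_const _ hg]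
  have hμ1 : μ Set.univ = 1 + ∫⁻ z, kernelOp Q 1 z ∂μ := by
    simpa using hμrec measurable_one
  have hμg : ∫⁻ z, g z ∂μ = 1 := by
    have h1 := hμP (f := 1) measurable_one
    simp only [hP1, lintegral_one, Pi.one_apply, measure_univ, mul_one] at h1
    have hfin : ∫⁻ z, kernelOp Q 1 z ∂μ ≠ ∞ :=
      ne_top_of_le_ne_top hμuniv (hμ1 ▸ le_add_self)
    rw [hμ1, add_comm] at h1
    exact ((ENNReal.add_right_inj hfin).1 h1).symm
  have hμ0 : μ Set.univ ≠ 0 := by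
    rw [hμ1]; simp
  have hμinv : ∀ A, MeasurableSet A → ∫⁻ z, P z A ∂μ = μ A := by
    intro A hA
    have hAm : Measurable (A.indicator (1 : E → ℝ≥0∞)) := measurable_one.indicator hA
    have h1 : ∀ z, kernelOp P (A.indicator 1) z = P z A := fun z => lintegral_indicator_one hA
    calc ∫⁻ z, P z A ∂μ = ∫⁻ z, kernelOp P (A.indicator 1) z ∂μ := by simp only [h1]
      _ = ∫⁻ z, A.indicator 1 z ∂μ := by rw [hμP hAm, hμrec hAm, hμg, one_mul, add_comm]
      _ = μ A := lintegral_indicator_one hA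
  refine ⟨(μ Set.univ)⁻¹ • μ, ⟨⟨?_⟩, ?_⟩, ?_⟩
  · simp [ENNReal.inv_mul_cancel hμ0 hμuniv]
  · intro A hA
    rw [lintegral_smul_measure, hμinv A hA]
    simp
  rintro π ⟨hπprob, hπ⟩
  have hbind : π.bind P = π := by
    ext A hA
    rw [Measure.bind_apply hA P.measurable.aemeasurable, hπ A hA]
  have hstep : ∀ {f : E → ℝ≥0∞}, Measurable f →
      ∫⁻ z, f z ∂π = ∫⁻ z, kernelOp Q f z ∂π + (∫⁻ z, g z ∂π) * ∫⁻ z, f z ∂ν := by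
    intro f hf
    conv_lhs => rw [← hbind]
    rw [Measure.lintegral_bind P.measurable.aemeasurable hf.aemeasurable]
    change ∫⁻ z, kernelOp P f z ∂π = _
    simp only [hop]
    rw [lintegral_add_left (measurable_kernelOp Q hf), lintegral_mul_const _ hg]
  have hiter : ∀ {f : E → ℝ≥0∞}, Measurable f → ∀ n, ∫⁻ z, f z ∂π =
      ∫⁻ z, (kernelOp Q)^[n] f z ∂π
        + (∫⁻ z, g z ∂π) * ∑ k ∈ Finset.range n, ∫⁻ z, (kernelOp Q)^[k] f z ∂ν := by
    intro f hf n
    induction n with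
    | zero => simp
    | succ n ih =>
      rw [ih, hstep (measurable_kernelOp_iterate Q hf n), Finset.sum_range_succ,
        Function.iterate_succ_apply']
      ring
  have hlim : ∀ {A : Set E}, MeasurableSet A → π A = (∫⁻ z, g z ∂π) * μ A := by
    intro A hA
    have hAm : Measurable (A.indicator (1 : E → ℝ≥0∞)) := measurable_one.indicator hA
    have hA1 : A.indicator (1 : E → ℝ≥0∞) ≤ 1 := Set.indicator_le_self _ _
    have hle1 : ∀ n z, (kernelOp Q)^[n] (A.indicator 1) z ≤ 1 := by
      intro n
      induction n with
      | zero => exact hA1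
      | succ n ih =>
        intro z
        rw [Function.iterate_succ_apply', ← hP1 z]
        exact (hQP _ z).trans (kernelOp_mono P ih z)
    have hto0 : Filter.Tendsto (fun n => ∫⁻ z, (kernelOp Q)^[n] (A.indicator 1) z ∂π)
        Filter.atTop (nhds 0) := by
      have := tendsto_lintegral_of_dominated_convergence (μ := π)
        (F := fun n z => (kernelOp Q)^[n] (A.indicator 1) z) (f := fun _ => 0) (fun _ => 1)
        (fun n => measurable_kernelOp_iterate Q hAm n)
        (fun n => Filter.Eventually.of_forall (hle1 n)) (by simp)
        (Filter.Eventually.of_forall fun z => ENNReal.tendsto_atTop_zero_of_tsum_ne_top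
          (ne_top_of_le_ne_top (ENNReal.add_ne_top.2 ⟨hVfin z, hcfin⟩)
            ((potential_mono Q hA1 z).trans (hpot z))))
      simpa using this
    have hgfin : ∫⁻ z, g z ∂π ≠ ∞ :=
      ne_top_of_le_ne_top (b := 1) (by simp) ((lintegral_mono (hPg1 0)).trans (by simp))
    have hsum : Filter.Tendsto
        (fun n => ∑ k ∈ Finset.range n, ∫⁻ z, (kernelOp Q)^[k] (A.indicator 1) z ∂ν)
        Filter.atTop (nhds (μ A)) := by
      have h1 : μ A = ∑' n, ∫⁻ z, (kernelOp Q)^[n] (A.indicator 1) z ∂ν := by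
        rw [← lintegral_potentialMeasure Q hAm ν, lintegral_indicator_one hA]
      rw [h1]
      exact ENNReal.tendsto_nat_tsum _
    have hlim2 := hto0.add (ENNReal.Tendsto.const_mul hsum (Or.inr hgfin))
    simp only [← hiter hAm, zero_add, lintegral_indicator_one hA] at hlim2
    exact tendsto_nhds_unique tendsto_const_nhds hlim2
  have hπg : ∫⁻ z, g z ∂π = (μ Set.univ)⁻¹ := by
    have h1 := hlim MeasurableSet.univ
    rw [measure_univ] at h1
    exact ENNReal.eq_inv_of_mul_eq_one_left h1.symm
  ext A hA
  rw [hlim hA, hπg]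
  simp

/-- A drift condition towards the states from which a small set `S` is accessible yields a unique
invariant probability measure. -/
theorem existsUnique_invariant_of_minorization {E : Type*} [MeasurableSpace E]
    (P : Kernel E E) [IsMarkovKernel P] (ν : Measure E) [IsProbabilityMeasure ν]
    {S : Set E} (hS : MeasurableSet S) (hSne : S.Nonempty) {ε : ℝ≥0∞} (hε : ε ≠ 0)
    (hε' : ε ≠ ∞) (hmin : ∀ z ∈ S, ε • ν ≤ P z)
    {V : E → ℝ≥0∞} (hV : Measurable V) (hVfin : ∀ z, V z ≠ ∞)
    {b : ℝ≥0∞} (hb : b ≠ ∞) (N : ℕ)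
    (hdrift : ∀ z, kernelOp P V z + 1 ≤
      V z + b * ∑ k ∈ Finset.range N, (kernelOp P)^[k] (S.indicator 1) z) :
    ∃! π : Measure E, IsProbabilityMeasure π ∧
      ∀ A : Set E, MeasurableSet A → ∫⁻ z, P z A ∂π = π A := by
  set g : E → ℝ≥0∞ := S.indicator fun _ => ε with hgdef
  have hg : Measurable g := measurable_const.indicator hS
  have hle : ∀ z, g z • ν ≤ P z := by
    intro z
    by_cases hz : z ∈ S
    · simpa [hgdef, hz] using hmin z hz
    · simp [hgdef, hz, Measure.zero_le]
  have hfin : ∀ z, IsFiniteMeasure (g z • ν) := fun z => isFiniteMeasure_of_le (P z) (hle z)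
  let Q : Kernel E E :=
    { toFun := fun z => P z - g z • ν
      measurable' := by
        refine Measure.measurable_of_measurable_coe _ fun A hA => ?_
        have h : ∀ z, (P z - g z • ν) A = P z A - g z * ν A := fun z => by
          have := hfin z
          rw [Measure.sub_apply hA (hle z)]
          rfl
        simp only [h]
        exact (P.measurable_coe hA).sub (hg.mul_const _) }
  have hdec : ∀ z, P z = Q z + g z • ν := fun z => by
    have := hfin z
    exact (Measure.sub_add_cancel_of_le (hle z)).symm
  have hone : ∀ k z, (kernelOp P)^[k] (S.indicator 1) z = ε⁻¹ * (kernelOp P)^[k] g z := by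
    intro k
    induction k with
    | zero =>
      intro z
      by_cases hz : z ∈ S
      · simp [hgdef, hz, ENNReal.inv_mul_cancel hε hε']
      · simp [hgdef, hz]
    | succ k ih =>
      intro z
      rw [Function.iterate_succ_apply', Function.iterate_succ_apply', kernelOp]
      simp only [ih]
      exact lintegral_const_mul _ (measurable_kernelOp_iterate P hg k)
  have hle1 : ∀ k z, (kernelOp P)^[k] (S.indicator 1) z ≤ 1 := by
    intro k
    induction k with
    | zero => exact Set.indicator_le_self _ _
    | succ k ih =>
      intro z
      rw [Function.iterate_succ_apply']
      exact (kernelOp_mono P (g := 1) ih z).trans (by simp [kernelOp])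
  obtain ⟨z₀, hz₀⟩ := hSne
  have hνV : ∫⁻ z, V z ∂ν ≠ ∞ := by
    have h1 : ε * ∫⁻ z, V z ∂ν ≤ V z₀ + b * ∑ k ∈ Finset.range N, (1 : ℝ≥0∞) := by
      calc ε * ∫⁻ z, V z ∂ν = ∫⁻ z, V z ∂(ε • ν) := by rw [lintegral_smul_measure, smul_eq_mul]
        _ ≤ kernelOp P V z₀ := lintegral_mono' (hmin z₀ hz₀) le_rfl
        _ ≤ _ := le_self_add.trans (hdrift z₀)
        _ ≤ _ := by
          gcongr
          exact hle1 _ z₀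
    intro htop
    rw [htop, ENNReal.mul_top hε, top_le_iff] at h1
    exact (ENNReal.add_ne_top.2 ⟨hVfin z₀, ENNReal.mul_ne_top hb (by simp)⟩) h1
  refine existsUnique_invariant_of_regeneration P Q ν hg hdec hV hVfin hνV
    (b := b * ε⁻¹) (ENNReal.mul_ne_top hb (ENNReal.inv_ne_top.2 hε)) N fun z => ?_
  simpa only [hone, ← Finset.mul_sum, ← mul_assoc] using hdrift z

section Quantizer

lemma abs_sub_Qq_le (K : ℕ) {Δ x : ℝ} (hΔ : 0 < Δ) (hx : |x| ≤ (K : ℝ) / 2 * Δ) :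
    |x - Qq K Δ x| ≤ Δ / 2 := by
  unfold Qq
  split_ifs with h
  · rw [h, abs_le]
    constructor <;> linarith
  · set t := x / Δ + (K : ℝ) / 2 with ht
    have hxt : x = (t - (K : ℝ) / 2) * Δ := by rw [ht]; field_simp; ring
    have h1 := Int.floor_le t
    have h2 := Int.lt_floor_add_one t
    have h3 : x - ((⌊t⌋ : ℝ) + 1 - ((K : ℝ) + 1) / 2) * Δ = (t - ⌊t⌋ - 1 / 2) * Δ := by
      rw [hxt]; ring
    rw [h3, abs_le]
    constructor <;> nlinarith

lemma Qq_eq_zero (K : ℕ) {Δ x : ℝ} (hΔ : 0 < Δ) (hx : (K : ℝ) / 2 * Δ < |x|) : Qq K Δ x = 0 := by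
  unfold Qq
  have hne : x ≠ (K : ℝ) / 2 * Δ := by
    rintro rfl
    rw [abs_of_nonneg (by positivity)] at hx
    exact lt_irrefl _ hx
  rw [if_neg hne, if_neg (not_le.2 hx)]

end Quantizer

section Gaussian

lemma exists_smul_volume_le_map_gaussianReal {v : NNReal} (hv : 0 < v) (M : ℝ) :
    ∃ ε : ℝ≥0∞, ε ≠ 0 ∧ ε ≠ ∞ ∧ ∀ m : ℝ, |m| ≤ M →
      ε • volume.restrict (Set.Icc (0 : ℝ) 1) ≤ (gaussianReal 0 v).map (fun u => m + u) := by
  have hvR : (0 : ℝ) < v := hv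
  set r : ℝ := (Real.sqrt (2 * Real.pi * v))⁻¹ * Real.exp (-(1 + M) ^ 2 / (2 * v)) with hr
  have hrpos : 0 < r := by positivity
  refine ⟨ENNReal.ofReal r, by simpa using hrpos, ENNReal.ofReal_ne_top, fun m hm => ?_⟩
  rw [gaussianReal_map_const_add, gaussianReal_of_var_ne_zero _ hv.ne']
  refine Measure.le_iff.2 fun A hA => ?_
  rw [Measure.smul_apply, smul_eq_mul, withDensity_apply _ hA, Measure.restrict_apply hA]
  calc ENNReal.ofReal r * volume (A ∩ Set.Icc 0 1)
      = ∫⁻ _ in A ∩ Set.Icc 0 1, ENNReal.ofReal r := by simp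
    _ ≤ ∫⁻ y in A ∩ Set.Icc 0 1, gaussianPDF (0 + m) v y := by
        refine setLIntegral_mono' (hA.inter measurableSet_Icc) fun y hy => ?_
        refine ENNReal.ofReal_le_ofReal ?_
        rw [hr, gaussianPDFReal]
        have h1 : |y - (0 + m)| ≤ 1 + M := by
          have := hy.2.1; have := hy.2.2
          rw [abs_le] at hm ⊢
          constructor <;> linarith [hm.1, hm.2]
        have h2 : (y - (0 + m)) ^ 2 ≤ (1 + M) ^ 2 := sq_le_sq' (abs_le.1 h1).1 (abs_le.1 h1).2
        gcongr
    _ ≤ ∫⁻ y in A, gaussianPDF (0 + m) v y :=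
        lintegral_mono_set Set.inter_subset_left

end Gaussian

section Lyapunov

/-- The Lyapunov function: a multiple of the log bin size, plus an overflow penalty. -/
noncomputable def lyap (κ C₁ C₂ η x Δ : ℝ) : ℝ :=
  C₁ * Real.log Δ + C₂ * max (|x| / (κ * Δ) - η) 0

variable {κ C₁ C₂ η : ℝ}

lemma lyap_nonneg (hC₁ : 0 ≤ C₁) (hC₂ : 0 ≤ C₂) (x : ℝ) {Δ : ℝ} (hΔ : 1 ≤ Δ) :
    0 ≤ lyap κ C₁ C₂ η x Δ :=
  add_nonneg (mul_nonneg hC₁ (Real.log_nonneg hΔ)) (mul_nonneg hC₂ (le_max_right _ _))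

lemma lyap_add_le (hκ : 0 < κ) (hC₂ : 0 ≤ C₂) (m u : ℝ) {Δ : ℝ} (hΔ : 1 ≤ Δ) :
    lyap κ C₁ C₂ η (m + u) Δ ≤ lyap κ C₁ C₂ η m Δ + C₂ / (κ * Δ) * |u| := by
  have hpos : 0 < κ * Δ := by positivity
  have h1 : |m + u| / (κ * Δ) ≤ |m| / (κ * Δ) + |u| / (κ * Δ) := by
    rw [← add_div]
    gcongr
    exact abs_add_le m u
  have h2 : 0 ≤ |u| / (κ * Δ) := by positivity
  have h3 : max (|m + u| / (κ * Δ) - η) 0 ≤ max (|m| / (κ * Δ) - η) 0 + |u| / (κ * Δ) := by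
    refine max_le ?_ (add_nonneg (le_max_right _ _) h2)
    linarith [le_max_left (|m| / (κ * Δ) - η) 0]
  have h4 := mul_le_mul_of_nonneg_left h3 hC₂
  have h5 : C₂ / (κ * Δ) * |u| = C₂ * (|u| / (κ * Δ)) := by ring
  unfold lyap
  rw [h5]
  linarith

lemma lintegral_lyap_le {γ : Measure ℝ} [IsProbabilityMeasure γ]
    (hγ : Integrable (fun u : ℝ => |u|) γ) (hκ : 0 < κ) (hC₁ : 0 ≤ C₁) (hC₂ : 0 ≤ C₂) (m : ℝ)
    {Δ : ℝ} (hΔ : 1 ≤ Δ) :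
    ∫⁻ u, ENNReal.ofReal (lyap κ C₁ C₂ η (m + u) Δ) ∂γ
      ≤ ENNReal.ofReal (lyap κ C₁ C₂ η m Δ + C₂ / (κ * Δ) * ∫ u, |u| ∂γ) := by
  have h0 := lyap_nonneg (κ := κ) (η := η) hC₁ hC₂ m hΔ
  have hB : 0 ≤ C₂ / (κ * Δ) := by positivity
  calc ∫⁻ u, ENNReal.ofReal (lyap κ C₁ C₂ η (m + u) Δ) ∂γ
      ≤ ∫⁻ u, ENNReal.ofReal (lyap κ C₁ C₂ η m Δ + C₂ / (κ * Δ) * |u|) ∂γ :=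
        lintegral_mono fun u => ENNReal.ofReal_le_ofReal (lyap_add_le hκ hC₂ m u hΔ)
    _ = ENNReal.ofReal (∫ u, (lyap κ C₁ C₂ η m Δ + C₂ / (κ * Δ) * |u|) ∂γ) :=
        (ofReal_integral_eq_lintegral_ofReal ((integrable_const _).add (hγ.const_mul _))
          (Filter.Eventually.of_forall fun u => add_nonneg h0 (mul_nonneg hB (abs_nonneg u)))).symm
    _ = _ := by
        rw [integral_add (integrable_const _) (hγ.const_mul _), integral_const_mul]
        simp

lemma lyap_add_noise_le {α Δ Δ' m θ E : ℝ} (hκ : 1 ≤ κ) (hC₂ : 0 ≤ C₂) (hα : 0 < α) (hΔ : 1 ≤ Δ)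
    (hΔ' : α * Δ ≤ Δ') (hE : 0 ≤ E) (hm : |m| ≤ θ * (κ * Δ')) :
    lyap κ C₁ C₂ η m Δ' + C₂ / (κ * Δ') * E
      ≤ C₁ * Real.log Δ' + C₂ * max (θ - η) 0 + C₂ * E / α / Δ := by
  have hΔ'0 : 0 < Δ' := lt_of_lt_of_le (by positivity) hΔ'
  have hpos : 0 < κ * Δ' := by positivity
  have h1 : |m| / (κ * Δ') ≤ θ := by rwa [div_le_iff₀ hpos]
  have h2 : C₂ / (κ * Δ') * E ≤ C₂ * E / α / Δ := by
    rw [div_mul_eq_mul_div, div_div]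
    exact div_le_div_of_nonneg_left (by positivity) (by positivity)
      (hΔ'.trans (le_mul_of_one_le_left hΔ'0.le hκ))
  unfold lyap
  gcongr

end Lyapunov

section Drift

variable {a α δ L p : ℝ}

lemma Hf_false (Δ h : ℝ) : Hf a δ α L Δ h false = |a| + δ := by simp [Hf]

lemma Hf_overflow (Δ : ℝ) {h : ℝ} (υ : Bool) (hh : 1 < |h|) : Hf a δ α L Δ h υ = |a| + δ := by
  simp [Hf, hh]

lemma Hf_zoom_in {Δ h : ℝ} (hh : |h| ≤ 1) (hΔ : L ≤ Δ) : Hf a δ α L Δ h true = α := by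
  simp [Hf, not_lt.2 hh, hΔ]

lemma Hf_stay {Δ h : ℝ} (hh : |h| ≤ 1) (hΔ : Δ < L) : Hf a δ α L Δ h true = 1 := by
  simp [Hf, not_lt.2 hh, not_le.2 hΔ]

lemma log_drift_neg (hα0 : 0 < α) (hρ : 0 < |a| + δ) (hp0 : 0 < p)
    (hrate : α * (|a| + δ) ^ ((1 : ℝ) / p - 1) < 1) :
    p * Real.log α + (1 - p) * Real.log (|a| + δ) < 0 := by
  have h1 := Real.log_neg (mul_pos hα0 (Real.rpow_pos_of_pos hρ _)) hrate
  rw [Real.log_mul hα0.ne' (Real.rpow_pos_of_pos hρ _).ne', Real.log_rpow hρ] at h1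
  have h2 := mul_neg_of_pos_of_neg hp0 h1
  have h3 : p * (Real.log α + (1 / p - 1) * Real.log (|a| + δ))
      = p * Real.log α + (1 - p) * Real.log (|a| + δ) := by
    field_simp
  linarith

/-- The one-step drift inequality for `lyap`, with the noise replaced by its mean modulus `E`. -/
lemma exists_lyap_drift {K : ℕ} (ha : 1 ≤ |a|) (hK : 2 ≤ K) (hα0 : 0 < α) (hα1 : α < 1)
    (hαa : |a| / (K : ℝ) < α) (hδ0 : 0 < δ) (hp0 : 0 < p) (hp1 : p < 1)
    (hrate : α * (|a| + δ) ^ ((1 : ℝ) / p - 1) < 1) {E : ℝ} (hE : 0 ≤ E) :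
    ∃ C₁ C₂ η M M' b : ℝ, 0 ≤ C₁ ∧ 0 ≤ C₂ ∧ 0 ≤ b ∧ ∀ x Δ Δ₁ Δ₀ : ℝ, 1 ≤ Δ →
      Δ₁ = Δ * Hf a δ α L Δ (x / ((K : ℝ) / 2 * Δ)) true →
      Δ₀ = Δ * Hf a δ α L Δ (x / ((K : ℝ) / 2 * Δ)) false →
      p * (lyap (K / 2) C₁ C₂ η (a * (x - Qq K Δ x)) Δ₁ + C₂ / (K / 2 * Δ₁) * E)
        + (1 - p) * (lyap (K / 2) C₁ C₂ η (a * x) Δ₀ + C₂ / (K / 2 * Δ₀) * E) + 1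
        ≤ lyap (K / 2) C₁ C₂ η x Δ
          + b * ({w : ℝ × ℝ | |w.1| ≤ M ∧ w.2 ≤ M'}.indicator 1 (x, Δ)) := by
  have hρ1 : 1 < |a| + δ := by linarith
  have hρ0 : 0 < |a| + δ := by linarith
  have hK2 : (2 : ℝ) ≤ K := by exact_mod_cast hK
  have hKpos : (0 : ℝ) < K := by linarith
  have hκ : (1 : ℝ) ≤ K / 2 := by linarith
  set ρ := |a| + δ with hρ
  set lam := p * Real.log α + (1 - p) * Real.log ρ with hlam
  have hlam0 : lam < 0 := log_drift_neg hα0 hρ0 hp0 hrate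
  set C₁ := -2 / lam with hC₁
  have hC₁0 : 0 ≤ C₁ := (div_pos_of_neg_of_neg (by norm_num) hlam0).le
  set lr := C₁ * Real.log ρ with hlr
  have hlr0 : 0 ≤ lr := mul_nonneg hC₁0 (Real.log_nonneg hρ1.le)
  have hmean : p * (C₁ * Real.log α) + (1 - p) * lr = -2 := by
    have h : p * (C₁ * Real.log α) + (1 - p) * lr = C₁ * lam := by rw [hlr, hlam]; ring
    rw [h, hC₁, div_mul_cancel₀ _ hlam0.ne]
  set η := max (|a| / ρ) (|a| / (K * α)) with hη
  have hη1 : η < 1 := by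
    refine max_lt ?_ ?_
    · rw [div_lt_one hρ0]; linarith
    · rw [div_lt_one (by positivity)]
      rw [div_lt_iff₀ hKpos] at hαa
      linarith
  have hη0 : 0 ≤ η := le_max_of_le_left (by positivity)
  have hβη : |a| / ρ ≤ η := le_max_left _ _
  have hαη : |a| / (K * α) ≤ η := le_max_right _ _
  set C₂ := (lr + 2) / (1 - η) with hC₂
  have hC₂0 : 0 ≤ C₂ := div_nonneg (by linarith) (by linarith)
  have hC₂η : C₂ * (1 - η) = lr + 2 := div_mul_cancel₀ _ (by linarith)
  set nz := C₂ * E / α with hnz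
  have hnz0 : 0 ≤ nz := by positivity
  set b := lr + nz + 1 with hb
  have hb0 : 0 ≤ b := by positivity
  refine ⟨C₁, C₂, η, b * (K / 2 * max L nz), max L nz, b, hC₁0, hC₂0, hb0, ?_⟩
  intro x Δ Δ₁ Δ₀ hΔ hΔ₁ hΔ₀
  have hΔ0 : 0 < Δ := by linarith
  have hκΔ : 0 < (K : ℝ) / 2 * Δ := by positivity
  set h := |x| / ((K : ℝ) / 2 * Δ) with hh
  have hh0 : 0 ≤ h := by positivity
  have hxh : |x| = h * ((K : ℝ) / 2 * Δ) := (div_mul_cancel₀ _ hκΔ.ne').symm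
  have habs : |x / ((K : ℝ) / 2 * Δ)| = h := by rw [abs_div, abs_of_pos hκΔ]
  set y := nz / Δ with hy
  have hy0 : 0 ≤ y := by positivity
  have hynz : y ≤ nz := div_le_self hnz0 hΔ
  set I : ℝ := {w : ℝ × ℝ | |w.1| ≤ b * (K / 2 * max L nz) ∧ w.2 ≤ max L nz}.indicator 1 (x, Δ)
    with hI
  have hI0 : 0 ≤ I := Set.indicator_nonneg (fun _ _ => zero_le_one) _
  have hI1 : h ≤ b → Δ ≤ max L nz → I = 1 := by
    intro h1 h2
    rw [hI, Set.indicator_of_mem]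
    · rfl
    refine ⟨?_, h2⟩
    change |x| ≤ _
    rw [hxh]
    gcongr
  have hnotC : Δ ≤ max L nz → h ≤ b → b * I = b := fun h1 h2 => by rw [hI1 h2 h1, mul_one]
  have hbig : max L nz < Δ → y ≤ 1 := fun h1 => by
    rw [hy, div_le_one hΔ0]; exact (le_max_right _ _).trans h1.le
  have hbI : 0 ≤ b * I := mul_nonneg hb0 hI0
  have hout : ∀ m Δ', Δ' = Δ * ρ → m = a * x →
      lyap (K / 2) C₁ C₂ η m Δ' + C₂ / (K / 2 * Δ') * E
        ≤ lr + C₁ * Real.log Δ + C₂ * max (|a| / ρ * h - η) 0 + y := by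
    rintro m Δ' rfl rfl
    refine (lyap_add_noise_le (θ := |a| / ρ * h) hκ hC₂0 hα0 hΔ ?_ hE ?_).trans_eq ?_
    · rw [mul_comm]
      exact mul_le_mul_of_nonneg_left (hα1.le.trans hρ1.le) hΔ0.le
    · rw [abs_mul, hxh]
      apply le_of_eq
      field_simp
    · rw [Real.log_mul hΔ0.ne' hρ0.ne', hlr]; ring
  have hin : ∀ c Δ', α ≤ c → Δ' = Δ * c → h ≤ 1 →
      lyap (K / 2) C₁ C₂ η (a * (x - Qq K Δ x)) Δ' + C₂ / (K / 2 * Δ') * E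
        ≤ C₁ * Real.log c + C₁ * Real.log Δ + y := by
    rintro c Δ' hc rfl hh1
    have hc0 : 0 < c := by linarith
    have hq : |x - Qq K Δ x| ≤ Δ / 2 := abs_sub_Qq_le K hΔ0 (by
      rw [hxh]; exact mul_le_of_le_one_left hκΔ.le hh1)
    refine (lyap_add_noise_le (θ := η) hκ hC₂0 hα0 hΔ ?_ hE ?_).trans_eq ?_
    · rw [mul_comm]
      exact mul_le_mul_of_nonneg_left hc hΔ0.le
    · rw [abs_mul]
      calc |a| * |x - Qq K Δ x| ≤ |a| * (Δ / 2) := by gcongr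
        _ = |a| / (K * α) * (K / 2 * (Δ * α)) := by field_simp
        _ ≤ η * (K / 2 * (Δ * c)) := by gcongr
    · rw [Real.log_mul hΔ0.ne' hc0.ne', sub_self, max_self]; ring
  have hV : lyap (K / 2) C₁ C₂ η x Δ = C₁ * Real.log Δ + C₂ * max (h - η) 0 := rfl
  have hVge : C₁ * Real.log Δ ≤ lyap (K / 2) C₁ C₂ η x Δ := by
    rw [hV]
    exact le_add_of_nonneg_right (mul_nonneg hC₂0 (le_max_right _ _))
  have hp1' : 0 ≤ 1 - p := by linarith
  rcases lt_or_ge 1 h with hover | hgran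
  · have hQ : Qq K Δ x = 0 := Qq_eq_zero K hΔ0 (by rw [hxh]; exact lt_mul_of_one_lt_left hκΔ hover)
    rw [Hf_overflow _ _ (by rwa [habs])] at hΔ₁
    rw [Hf_false] at hΔ₀
    have hY1 := mul_le_mul_of_nonneg_left (hout (a * (x - Qq K Δ x)) Δ₁ hΔ₁ (by rw [hQ, sub_zero]))
      hp0.le
    have hY0 := mul_le_mul_of_nonneg_left (hout _ Δ₀ hΔ₀ rfl) hp1'
    have hmax : C₂ * max (|a| / ρ * h - η) 0 ≤ C₂ * (η * h - η) := by
      refine mul_le_mul_of_nonneg_left (max_le ?_ ?_) hC₂0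
      · gcongr
      · exact sub_nonneg.2 (le_mul_of_one_le_right hη0 hover.le)
    have hVeq : lyap (K / 2) C₁ C₂ η x Δ = C₁ * Real.log Δ + C₂ * (h - η) := by
      rw [hV, max_eq_left (by linarith)]
    have hkey : C₂ * (h - η) - C₂ * (η * h - η) = (lr + 2) * h := by rw [← hC₂η]; ring
    have hh2 : lr + 2 ≤ (lr + 2) * h := le_mul_of_one_le_right (by linarith) hover.le
    have hgoal : lr + y + 1 ≤ (lr + 2) * h + b * I := by
      rcases lt_or_ge (max L nz) Δ with hΔM | hΔM
      · linarith [hbig hΔM]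
      · rcases lt_or_ge b h with hM | hM
        · have : h ≤ (lr + 2) * h := le_mul_of_one_le_left hh0 (by linarith)
          linarith
        · linarith [hnotC hΔM hM]
    rw [hVeq]
    linarith
  · rw [Hf_false] at hΔ₀
    have hY0 := mul_le_mul_of_nonneg_left (hout _ Δ₀ hΔ₀ rfl) hp1'
    have hmax : C₂ * max (|a| / ρ * h - η) 0 = 0 := by
      rw [max_eq_right, mul_zero]
      have : |a| / ρ * h ≤ |a| / ρ := mul_le_of_le_one_right (by positivity) hgran
      linarith
    rw [hmax] at hY0
    have hb1 : h ≤ b := by linarith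
    rcases le_or_gt L Δ with hL | hL
    · rw [Hf_zoom_in (by rwa [habs]) hL] at hΔ₁
      have hY1 := mul_le_mul_of_nonneg_left (hin α Δ₁ le_rfl hΔ₁ hgran) hp0.le
      have hgoal : y ≤ 1 + b * I := by
        rcases lt_or_ge (max L nz) Δ with hΔM | hΔM
        · linarith [hbig hΔM]
        · linarith [hnotC hΔM hb1]
      linarith
    · rw [Hf_stay (by rwa [habs]) hL] at hΔ₁
      have hY1 := mul_le_mul_of_nonneg_left (hin 1 Δ₁ hα1.le hΔ₁ hgran) hp0.le
      rw [Real.log_one, mul_zero] at hY1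
      have := hnotC (hL.le.trans (le_max_left _ _)) hb1
      have hplr := mul_nonneg hp0.le hlr0
      linarith

end Drift

section Accessibility

/-- The law of `(y, Δ)` with `y` uniform on `[0, 1]`. -/
noncomputable def unifAt {D : Type*} [MeasurableSpace D] (Δ : D) : Measure (ℝ × D) :=
  (volume.restrict (Set.Icc (0 : ℝ) 1)).map fun y => (y, Δ)

variable {D : Type*} [MeasurableSpace D]

instance (Δ : D) : IsProbabilityMeasure (unifAt Δ) :=
  have : IsProbabilityMeasure (volume.restrict (Set.Icc (0 : ℝ) 1)) := ⟨by simp⟩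
  Measure.isProbabilityMeasure_map (by fun_prop)

/-- From bin size `Δ` and `|x| ≤ M`, one step of `P` dominates a multiple of `unifAt Δ'`. -/
def HasStep (P : Kernel (ℝ × D) (ℝ × D)) (M : ℝ) (Δ Δ' : D) : Prop :=
  ∃ ε : ℝ≥0∞, ε ≠ 0 ∧ ε ≠ ∞ ∧ ∀ x : ℝ, |x| ≤ M → ε • unifAt Δ' ≤ P (x, Δ)

/-- `S` is reached by the chain, in some number of steps and with probability bounded below, from
all states with bin size `Δ` and `|x| ≤ M`. -/
def Accessible (P : Kernel (ℝ × D) (ℝ × D)) (S : Set (ℝ × D)) (M : ℝ) (Δ : D) : Prop :=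
  ∃ (k : ℕ) (c : ℝ≥0∞), c ≠ ∞ ∧
    ∀ x : ℝ, |x| ≤ M → 1 ≤ c * (kernelOp P)^[k] (S.indicator 1) (x, Δ)

lemma HasStep.accessible {P : Kernel (ℝ × D) (ℝ × D)} {S : Set (ℝ × D)} (hS : MeasurableSet S)
    {M : ℝ} {Δ Δ' : D} (h : HasStep P M Δ Δ') (h' : Accessible P S 1 Δ') :
    Accessible P S M Δ := by
  obtain ⟨ε, hε0, hε, hstep⟩ := h
  obtain ⟨k, c, hc, hacc⟩ := h'
  refine ⟨k + 1, c * ε⁻¹, ENNReal.mul_ne_top hc (ENNReal.inv_ne_top.2 hε0), fun x hx => ?_⟩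
  set f := (kernelOp P)^[k] (S.indicator 1) with hf
  have hfm : Measurable f := measurable_kernelOp_iterate P (measurable_one.indicator hS) k
  have hpair : Measurable fun y : ℝ => (y, Δ') := by fun_prop
  have h1 : 1 ≤ c * ∫⁻ w, f w ∂(unifAt Δ') := by
    rw [unifAt, lintegral_map hfm hpair, ← lintegral_const_mul c (f := fun y => f (y, Δ')) (hfm.comp hpair)]
    calc (1 : ℝ≥0∞) = ∫⁻ _ in Set.Icc (0 : ℝ) 1, 1 := by simp
      _ ≤ _ := setLIntegral_mono' measurableSet_Icc fun y hy =>
        hacc y (abs_le.2 ⟨by linarith [hy.1], hy.2⟩)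
  have h2 : ε * ∫⁻ w, f w ∂(unifAt Δ') ≤ kernelOp P f (x, Δ) := by
    rw [← smul_eq_mul, ← lintegral_smul_measure]
    exact lintegral_mono' (hstep x hx) le_rfl
  rw [Function.iterate_succ_apply']
  calc 1 ≤ c * ∫⁻ w, f w ∂(unifAt Δ') := h1
    _ = c * ε⁻¹ * (ε * ∫⁻ w, f w ∂(unifAt Δ')) := by
      rw [mul_assoc, ← mul_assoc ε⁻¹, ENNReal.inv_mul_cancel hε0 hε, one_mul]
    _ ≤ _ := by gcongr

lemma exists_uniform_accessible {P : Kernel (ℝ × D) (ℝ × D)} {S : Set (ℝ × D)} {M : ℝ}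
    {F : Set D} (hF : F.Finite) (hacc : ∀ Δ, Accessible P S M Δ) :
    ∃ (N : ℕ) (c : ℝ≥0∞), c ≠ ∞ ∧ ∀ x : ℝ, ∀ Δ ∈ F, |x| ≤ M →
      1 ≤ c * ∑ k ∈ Finset.range N, (kernelOp P)^[k] (S.indicator 1) (x, Δ) := by
  choose k c hc h using hacc
  refine ⟨∑ Δ ∈ hF.toFinset, k Δ + 1, ∑ Δ ∈ hF.toFinset, c Δ,
    ENNReal.sum_ne_top.2 fun Δ _ => hc Δ, fun x Δ hΔ hx => (h Δ x hx).trans ?_⟩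
  have hΔ' := hF.mem_toFinset.2 hΔ
  gcongr
  · exact Finset.single_le_sum (f := c) (fun _ _ => zero_le) hΔ'
  · refine Finset.single_le_sum (f := fun j => (kernelOp P)^[j] (S.indicator 1) (x, Δ))
      (fun _ _ => zero_le) (Finset.mem_range.2 (Nat.lt_succ_of_le ?_))
    exact Finset.single_le_sum (f := k) (fun _ _ => Nat.zero_le _) hΔ'

end Accessibility

section Lattice

variable {a α δ L s : ℝ}

lemma one_le_of_mem_Dset (hL' : 1 ≤ α * L) {Δ : ℝ} (hΔ : Δ ∈ Dset α L s) : 1 ≤ Δ :=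
  hL'.trans hΔ.1

lemma mul_mem_Dset_of_one_le (hL' : 1 ≤ α * L) {r : ℝ} (hr : 1 ≤ r) {n : ℤ}
    (hn : Real.logb 2 r = n * s) {Δ : ℝ} (hΔ : Δ ∈ Dset α L s) : Δ * r ∈ Dset α L s := by
  have h1 := one_le_of_mem_Dset hL' hΔ
  obtain ⟨hge, z, hz⟩ := hΔ
  refine ⟨by nlinarith, z + n, ?_⟩
  rw [Real.logb_mul (by positivity) (by positivity), hz, hn]
  push_cast; ring

lemma mul_mem_Dset_of_le (hα0 : 0 < α) (hL0 : 0 < L) {n : ℤ} (hn : Real.logb 2 α = n * s)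
    {Δ : ℝ} (hΔ : Δ ∈ Dset α L s) (hL : L ≤ Δ) : Δ * α ∈ Dset α L s := by
  obtain ⟨-, z, hz⟩ := hΔ
  have hΔ0 : 0 < Δ := by linarith
  refine ⟨by nlinarith, z + n, ?_⟩
  rw [Real.logb_mul (by positivity) (by positivity), hz, hn]
  push_cast; ring

lemma mul_Hf_mem_Dset (hL' : 1 ≤ α * L) (hα0 : 0 < α) (hL0 : 0 < L) (hρ : 1 ≤ |a| + δ) {m n : ℤ}
    (hm : Real.logb 2 α = m * s) (hn : Real.logb 2 (|a| + δ) = n * s)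
    {Δ : ℝ} (hΔ : Δ ∈ Dset α L s) (h : ℝ) (υ : Bool) : Δ * Hf a δ α L Δ h υ ∈ Dset α L s := by
  unfold Hf
  split_ifs with h1 h2
  · exact mul_mem_Dset_of_one_le hL' hρ hn hΔ
  · exact mul_mem_Dset_of_le hα0 hL0 hm hΔ h2
  · rwa [mul_one]

lemma Dset_subset_range (hL' : 1 ≤ α * L) :
    Dset α L s ⊆ Set.range fun z : ℤ => (2 : ℝ) ^ ((z : ℝ) * s) := by
  intro Δ hΔ
  have h1 := one_le_of_mem_Dset hL' hΔ
  obtain ⟨-, z, hz⟩ := hΔ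
  refine ⟨z, ?_⟩
  change (2 : ℝ) ^ ((z : ℝ) * s) = Δ
  rw [← hz, Real.rpow_logb (by norm_num) (by norm_num) (by linarith)]

lemma measurableSet_Dset (hL' : 1 ≤ α * L) : MeasurableSet (Dset α L s) :=
  ((Set.countable_range _).mono (Dset_subset_range hL')).measurableSet

lemma Dset_nonempty (hs : 0 < s) (hL' : 1 ≤ α * L) : (Dset α L s).Nonempty := by
  refine ⟨(2 : ℝ) ^ ((⌈Real.logb 2 (α * L) / s⌉ : ℝ) * s), ?_, ⌈Real.logb 2 (α * L) / s⌉, ?_⟩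
  · rw [← Real.logb_le_iff_le_rpow (by norm_num) (by linarith), ← div_le_iff₀ hs]
    exact Int.le_ceil _
  · rw [Real.logb_rpow (by norm_num) (by norm_num)]

lemma Dset_inter_Iic_finite (hs : 0 < s) (hL' : 1 ≤ α * L) (M : ℝ) :
    {Δ : ↥(Dset α L s) | (Δ : ℝ) ≤ M}.Finite := by
  refine Set.Finite.of_finite_image (f := Subtype.val) ?_ Subtype.val_injective.injOn
  refine ((Set.finite_Icc (0 : ℤ) ⌊Real.logb 2 M / s⌋).image
    fun z : ℤ => (2 : ℝ) ^ ((z : ℝ) * s)).subset ?_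
  rintro _ ⟨Δ, hΔM, rfl⟩
  have h1 := one_le_of_mem_Dset hL' Δ.2
  have hM : (Δ : ℝ) ≤ M := hΔM
  obtain ⟨-, z, hz⟩ := Δ.2
  refine ⟨z, ⟨?_, ?_⟩, ?_⟩
  · have h2 : 0 ≤ (z : ℝ) * s := hz ▸ Real.logb_nonneg (by norm_num) h1
    exact_mod_cast nonneg_of_mul_nonneg_left h2 hs
  · rw [Int.le_floor, le_div_iff₀ hs, ← hz]
    exact Real.logb_le_logb_of_le (by norm_num) (by linarith) hM
  · change (2 : ℝ) ^ ((z : ℝ) * s) = Δ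
    rw [← hz, Real.rpow_logb (by norm_num) (by norm_num) (by linarith)]

lemma exists_nat_combination {A B : ℕ} (hA : 0 < A) (hB : 0 < B) (hAB : Nat.Coprime A B) (d : ℤ) :
    ∃ u v : ℕ, ((u : ℤ) + 1) * B - v * A = d := by
  obtain ⟨x, y, hxy⟩ := Nat.isCoprime_iff_coprime.2 hAB
  have hA1 : (1 : ℤ) ≤ A := by exact_mod_cast hA
  have hB1 : (1 : ℤ) ≤ B := by exact_mod_cast hB
  set t : ℤ := |y * d| + |x * d| + 1 with ht
  have ht0 : 0 ≤ t := by positivity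
  have hu : 0 ≤ y * d + t * A - 1 := by
    nlinarith [neg_abs_le (y * d), abs_nonneg (x * d)]
  have hv : 0 ≤ -(x * d) + t * B := by
    nlinarith [le_abs_self (x * d), abs_nonneg (y * d)]
  refine ⟨(y * d + t * A - 1).toNat, (-(x * d) + t * B).toNat, ?_⟩
  rw [Int.toNat_of_nonneg hu, Int.toNat_of_nonneg hv]
  linear_combination d * hxy

lemma exists_mul_pow_eq {A B : ℕ} (hA : 0 < A) (hB : 0 < B) (hAB : Nat.Coprime A B)
    (hL' : 1 ≤ α * L) (hα0 : 0 < α) {ρ : ℝ} (hρ0 : 0 < ρ)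
    (hα : Real.logb 2 α = -(A : ℝ) * s) (hρ : Real.logb 2 ρ = (B : ℝ) * s)
    (Δ Δ' : ↥(Dset α L s)) : ∃ u v : ℕ, (Δ : ℝ) * ρ ^ (u + 1) * α ^ v = Δ' := by
  have h1 := one_le_of_mem_Dset hL' Δ.2
  have h1' := one_le_of_mem_Dset hL' Δ'.2
  obtain ⟨-, z, hz⟩ := Δ.2
  obtain ⟨-, z', hz'⟩ := Δ'.2
  obtain ⟨u, v, huv⟩ := exists_nat_combination hA hB hAB (z' - z)
  refine ⟨u, v, ?_⟩
  have hΔ0 : (0 : ℝ) < Δ := by linarith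
  have hΔ0' : (0 : ℝ) < Δ' := by linarith
  refine Real.logb_injOn_pos (b := 2) (by norm_num)
    (Set.mem_Ioi.2 (by positivity)) (Set.mem_Ioi.2 hΔ0') ?_
  rw [Real.logb_mul (by positivity) (by positivity), Real.logb_mul (by positivity) (by positivity),
    Real.logb_pow, Real.logb_pow, hz, hz', hα, hρ]
  have huv' : ((u : ℝ) + 1) * B - v * A = z' - z := by exact_mod_cast huv
  push_cast
  linear_combination s * huv'

end Lattice

section ZoomAccessibility

variable {α L s ρ : ℝ} {P : Kernel (ℝ × ↥(Dset α L s)) (ℝ × ↥(Dset α L s))}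
  {S : Set (ℝ × ↥(Dset α L s))} {Δs : ↥(Dset α L s)}

lemma accessible_of_mul_pow (hS : MeasurableSet S) (hα0 : 0 < α) (hα1 : α < 1) (hL0 : 0 < L)
    {n : ℤ} (hn : Real.logb 2 α = n * s)
    (hdown : ∀ Δ Δ' : ↥(Dset α L s), L ≤ Δ → (Δ' : ℝ) = Δ * α → HasStep P 1 Δ Δ')
    (hbase : Accessible P S 1 Δs) (v : ℕ) (Δ : ↥(Dset α L s)) (h : (Δ : ℝ) * α ^ v = Δs) :
    Accessible P S 1 Δ := by
  induction v generalizing Δ with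
  | zero =>
    rw [pow_zero, mul_one] at h
    rwa [Subtype.ext h]
  | succ v ih =>
    have hΔL : L ≤ Δ := by
      have h1 := Δs.2.1
      rw [← h, pow_succ'] at h1
      have h2 : L ≤ Δ * α ^ v := by
        refine le_of_mul_le_mul_left ?_ hα0
        linarith
      have h3 : α ^ v ≤ 1 := pow_le_one₀ hα0.le hα1.le
      have h4 : 0 ≤ (Δ : ℝ) := by
        by_contra! hneg
        have := mul_neg_of_neg_of_pos hneg (pow_pos hα0 v)
        linarith
      exact h2.trans (mul_le_of_le_one_right h4 h3)
    let Δ' : ↥(Dset α L s) := ⟨Δ * α, mul_mem_Dset_of_le hα0 hL0 hn Δ.2 hΔL⟩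
    refine (hdown Δ Δ' hΔL rfl).accessible hS (ih Δ' ?_)
    rw [← h, pow_succ']
    exact mul_assoc _ _ _

lemma accessible_of_mul_pow_mul_pow (hS : MeasurableSet S) (hL' : 1 ≤ α * L) (hα0 : 0 < α)
    (hα1 : α < 1) (hL0 : 0 < L) (hρ : 1 ≤ ρ) {m n : ℤ} (hn : Real.logb 2 α = n * s)
    (hm : Real.logb 2 ρ = m * s)
    (hdown : ∀ Δ Δ' : ↥(Dset α L s), L ≤ Δ → (Δ' : ℝ) = Δ * α → HasStep P 1 Δ Δ')
    (hup : ∀ M (Δ Δ' : ↥(Dset α L s)), (Δ' : ℝ) = Δ * ρ → HasStep P M Δ Δ')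
    (hbase : Accessible P S 1 Δs) (M : ℝ) (u v : ℕ) (Δ : ↥(Dset α L s))
    (h : (Δ : ℝ) * ρ ^ (u + 1) * α ^ v = Δs) :
    Accessible P S M Δ := by
  induction u generalizing Δ M with
  | zero =>
    let Δ' : ↥(Dset α L s) := ⟨Δ * ρ, mul_mem_Dset_of_one_le hL' hρ hm Δ.2⟩
    refine (hup M Δ Δ' rfl).accessible hS
      (accessible_of_mul_pow hS hα0 hα1 hL0 hn hdown hbase v Δ' ?_)
    simpa using h
  | succ u ih =>
    let Δ' : ↥(Dset α L s) := ⟨Δ * ρ, mul_mem_Dset_of_one_le hL' hρ hm Δ.2⟩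
    refine (hup M Δ Δ' rfl).accessible hS (ih 1 Δ' ?_)
    rw [← h, pow_succ' ρ (u + 1), ← mul_assoc (Δ : ℝ)]

end ZoomAccessibility

section ZoomKernel

variable {a α δ L p s : ℝ} {K : ℕ} {σ2 : NNReal}

lemma measurableEmbedding_prodMap_val (hL' : 1 ≤ α * L) :
    MeasurableEmbedding fun w : ℝ × ↥(Dset α L s) => (w.1, (w.2 : ℝ)) :=
  MeasurableEmbedding.id.prodMap (MeasurableEmbedding.subtype_coe (measurableSet_Dset hL'))

/-- The transition law on `ℝ × D` itself, recovered from its image in `ℝ × ℝ`. -/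
lemma eq_of_map_prodMap_val (hL' : 1 ≤ α * L) {m m' : ℝ} {Δ₁ Δ₀ : ↥(Dset α L s)}
    {μ : Measure (ℝ × ↥(Dset α L s))} {γ : Measure ℝ} {q q' : ℝ≥0∞}
    (h : μ.map (fun w : ℝ × ↥(Dset α L s) => (w.1, (w.2 : ℝ)))
      = q • γ.map (fun u : ℝ => (m + u, (Δ₁ : ℝ))) + q' • γ.map (fun u : ℝ => (m' + u, (Δ₀ : ℝ)))) :
    μ = q • γ.map (fun u : ℝ => (m + u, Δ₁)) + q' • γ.map (fun u : ℝ => (m' + u, Δ₀)) := by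
  have hι := measurableEmbedding_prodMap_val (s := s) hL'
  refine hι.map_injective ?_
  rw [h, Measure.map_add _ _ hι.measurable, Measure.map_smul, Measure.map_smul,
    Measure.map_map hι.measurable (by fun_prop), Measure.map_map hι.measurable (by fun_prop)]
  rfl

lemma smul_unifAt_le_map {D : Type*} [MeasurableSpace D] {γ : Measure ℝ} {ε : ℝ≥0∞} {m : ℝ}
    (h : ε • volume.restrict (Set.Icc (0 : ℝ) 1) ≤ γ.map (fun u => m + u)) (Δ : D) :
    ε • unifAt Δ ≤ γ.map fun u => (m + u, Δ) := by
  have hpair : Measurable fun y : ℝ => (y, Δ) := by fun_prop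
  rw [unifAt, ← Measure.map_smul]
  refine (Measure.map_mono h hpair).trans_eq ?_
  rw [Measure.map_map hpair (by fun_prop)]
  rfl

lemma integrable_abs_gaussianReal (v : NNReal) :
    Integrable (fun u : ℝ => |u|) (gaussianReal 0 v) := by
  have h : MemLp id 1 (gaussianReal 0 v) := memLp_id_gaussianReal 1
  exact (memLp_one_iff_integrable.1 h).abs

lemma ofReal_mul_add_ofReal_mul (hp0 : 0 < p) (hp1 : p < 1) {x y : ℝ} (hx : 0 ≤ x) (hy : 0 ≤ y) :
    ENNReal.ofReal p * ENNReal.ofReal x + ENNReal.ofReal (1 - p) * ENNReal.ofReal y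
      = ENNReal.ofReal (p * x + (1 - p) * y) := by
  have hp1' : 0 ≤ 1 - p := by linarith
  rw [← ENNReal.ofReal_mul hp0.le, ← ENNReal.ofReal_mul hp1',
    ← ENNReal.ofReal_add (by positivity) (by positivity)]

end ZoomKernel

/-- Under the recurrence condition and the coprime-integers
condition on `log₂ α` and `log₂(|a|+δ)`, the Markov kernel of the pair process
`(x_t, Δ_t)` on `ℝ × D` admits a unique invariant probability measure. -/
theorem stmt_18
    (a : ℝ) (K : ℕ) (α δ L p s : ℝ) (σ2 : NNReal)
    (ha : 1 ≤ |a|) (hK : 2 ≤ K) (hKeven : Even K)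
    (hα0 : 0 < α) (hα1 : α < 1) (hαa : |a| / (K : ℝ) < α)
    (hδ0 : 0 < δ) (hL0 : 0 < L) (hL' : 1 ≤ α * L)
    (hp0 : 0 < p) (hp1 : p < 1) (hσ : 0 < σ2) (hs : 0 < s)
    -- `Ã = −log₂(α)/s` and `B̃ = log₂(|a|+δ)/s` are positive coprime integers:
    (hAB : ∃ A B : ℕ, 0 < A ∧ 0 < B ∧ Nat.Coprime A B ∧
      Real.logb 2 α = -(A : ℝ) * s ∧ Real.logb 2 (|a| + δ) = (B : ℝ) * s)
    -- the recurrence condition `α (|a|+δ)^{1/p − 1} < 1`: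
    (hrate : α * (|a| + δ) ^ ((1 : ℝ) / p - 1) < 1)
    (P : ProbabilityTheory.Kernel (ℝ × ↥(Dset α L s)) (ℝ × ↥(Dset α L s)))
    [IsMarkovKernel P]
    -- `P((x,Δ),·)` is the law of `(a(x − Υ·Q_K^Δ(x)) + d, Δ·H(Δ,|h|,Υ))` with
    -- `d ~ N(0,σ²)` and `Υ ~ Bernoulli(p)` independent (identified through the
    -- embedding of `ℝ × D` into `ℝ × ℝ`):
    (hP : ∀ z : ℝ × ↥(Dset α L s),
      (P z).map (fun w : ℝ × ↥(Dset α L s) => (w.1, (w.2 : ℝ)))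
        = ENNReal.ofReal p •
            ((gaussianReal 0 σ2).map (fun u : ℝ =>
              (a * (z.1 - Qq K (z.2 : ℝ) z.1) + u,
               (z.2 : ℝ) * Hf a δ α L (z.2 : ℝ)
                 (z.1 / ((K : ℝ) / 2 * (z.2 : ℝ))) true)))
          + ENNReal.ofReal (1 - p) •
            ((gaussianReal 0 σ2).map (fun u : ℝ =>
              (a * z.1 + u,
               (z.2 : ℝ) * Hf a δ α L (z.2 : ℝ)
                 (z.1 / ((K : ℝ) / 2 * (z.2 : ℝ))) false)))
    ) :
    ∃! π : Measure (ℝ × ↥(Dset α L s)), IsProbabilityMeasure π ∧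
      ∀ A : Set (ℝ × ↥(Dset α L s)), MeasurableSet A →
        ∫⁻ z, P z A ∂π = π A := by
  obtain ⟨A, B, hA, hB, hcop, hlogα, hlogρ⟩ := hAB
  have hρ1 : 1 ≤ |a| + δ := by linarith
  have hρ0 : 0 < |a| + δ := by linarith
  have hκ : (0 : ℝ) < K / 2 := by
    have : (2 : ℝ) ≤ K := by exact_mod_cast hK
    linarith
  have hlogα' : Real.logb 2 α = ((-A : ℤ) : ℝ) * s := by rw [hlogα]; push_cast; rfl
  have hlogρ' : Real.logb 2 (|a| + δ) = ((B : ℤ) : ℝ) * s := by rw [hlogρ]; push_cast; rfl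
  let nxt (z : ℝ × ↥(Dset α L s)) (υ : Bool) : ↥(Dset α L s) :=
    ⟨z.2 * Hf a δ α L z.2 (z.1 / ((K : ℝ) / 2 * z.2)) υ,
      mul_Hf_mem_Dset hL' hα0 hL0 hρ1 hlogα' hlogρ' z.2.2 _ υ⟩
  have hPeq : ∀ z, P z = ENNReal.ofReal p • (gaussianReal 0 σ2).map
        (fun u => (a * (z.1 - Qq K z.2 z.1) + u, nxt z true))
      + ENNReal.ofReal (1 - p) • (gaussianReal 0 σ2).map (fun u => (a * z.1 + u, nxt z false)) :=
    fun z => eq_of_map_prodMap_val hL' (hP z)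
  have hpE : ENNReal.ofReal p ≠ 0 := by simpa using hp0
  have hpE' : ENNReal.ofReal (1 - p) ≠ 0 := by simpa using hp1
  have hup : ∀ M (Δ Δ' : ↥(Dset α L s)), (Δ' : ℝ) = Δ * (|a| + δ) → HasStep P M Δ Δ' := by
    intro M Δ Δ' hΔ'
    obtain ⟨ε, hε0, hε, h⟩ := exists_smul_volume_le_map_gaussianReal hσ (|a| * M)
    refine ⟨ENNReal.ofReal (1 - p) * ε, mul_ne_zero hpE' hε0,
      ENNReal.mul_ne_top ENNReal.ofReal_ne_top hε, fun x hx => ?_⟩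
    have hn : nxt (x, Δ) false = Δ' := Subtype.ext (by
      rw [hΔ']; exact congrArg _ (Hf_false _ _))
    have hm : |a * x| ≤ |a| * M := by rw [abs_mul]; gcongr
    rw [hPeq, hn, mul_smul]
    refine le_trans ?_ (Measure.le_add_left le_rfl)
    gcongr
    exact smul_unifAt_le_map (h _ hm) Δ'
  have hdown : ∀ Δ Δ' : ↥(Dset α L s), L ≤ Δ → (Δ' : ℝ) = Δ * α → HasStep P 1 Δ Δ' := by
    intro Δ Δ' hΔL hΔ'
    have hΔ1 := one_le_of_mem_Dset hL' Δ.2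
    obtain ⟨ε, hε0, hε, h⟩ := exists_smul_volume_le_map_gaussianReal hσ (|a| * (Δ / 2))
    refine ⟨ENNReal.ofReal p * ε, mul_ne_zero hpE hε0,
      ENNReal.mul_ne_top ENNReal.ofReal_ne_top hε, fun x hx => ?_⟩
    have hκΔ : 0 < (K : ℝ) / 2 * Δ := by positivity
    have hxΔ : |x| ≤ (K : ℝ) / 2 * Δ := by
      have : (2 : ℝ) ≤ K := by exact_mod_cast hK
      nlinarith
    have hgran : |x / ((K : ℝ) / 2 * Δ)| ≤ 1 := by
      rw [abs_div, abs_of_pos hκΔ]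
      exact (div_le_one hκΔ).2 hxΔ
    have hn : nxt (x, Δ) true = Δ' := Subtype.ext (by
      rw [hΔ']; exact congrArg _ (Hf_zoom_in hgran hΔL))
    have hm : |a * (x - Qq K Δ x)| ≤ |a| * (Δ / 2) := by
      rw [abs_mul]
      gcongr
      exact abs_sub_Qq_le K (by linarith) hxΔ
    rw [hPeq, hn, mul_smul]
    refine le_trans ?_ (Measure.le_add_right le_rfl)
    gcongr
    exact smul_unifAt_le_map (h _ hm) Δ'
  obtain ⟨Δs, hΔs⟩ := Dset_nonempty hs hL'
  let Δs : ↥(Dset α L s) := ⟨Δs, hΔs⟩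
  let S : Set (ℝ × ↥(Dset α L s)) := {z | |z.1| ≤ 1 ∧ z.2 = Δs}
  have hS : MeasurableSet S :=
    (measurableSet_le (measurable_norm.comp measurable_fst) measurable_const).inter
      (measurable_snd (measurableSet_singleton Δs))
  have hbase : Accessible P S 1 Δs := ⟨0, 1, one_ne_top, fun x hx => by
    rw [Function.iterate_zero_apply, Set.indicator_of_mem (show (x, Δs) ∈ S from ⟨hx, rfl⟩)]
    simp⟩
  have hacc : ∀ M Δ, Accessible P S M Δ := fun M Δ => by
    obtain ⟨u, v, huv⟩ := exists_mul_pow_eq hA hB hcop hL' hα0 hρ0 hlogα hlogρ Δ Δs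
    exact accessible_of_mul_pow_mul_pow hS hL' hα0 hα1 hL0 hρ1 hlogα' hlogρ' hdown hup hbase M u v
      Δ huv
  obtain ⟨C₁, C₂, η, M, M', b, hC₁, hC₂, hb, hdrift⟩ := exists_lyap_drift (L := L) ha hK hα0 hα1
    hαa hδ0 hp0 hp1 hrate (E := ∫ u, |u| ∂(gaussianReal 0 σ2))
    (integral_nonneg fun u => abs_nonneg u)
  obtain ⟨N, c, hc, hN⟩ := exists_uniform_accessible (P := P) (S := S) (M := M)
    (Dset_inter_Iic_finite hs hL' M') (hacc M)
  let V : ℝ × ↥(Dset α L s) → ℝ≥0∞ := fun z => ENNReal.ofReal (lyap (K / 2) C₁ C₂ η z.1 z.2)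
  have hV : Measurable V := by
    unfold V lyap
    fun_prop
  let Δs' : ↥(Dset α L s) := ⟨Δs * (|a| + δ), mul_mem_Dset_of_one_le hL' hρ1 hlogρ' Δs.2⟩
  obtain ⟨ε, hε0, hε, hmin⟩ := hup 1 Δs Δs' rfl
  refine existsUnique_invariant_of_minorization P (unifAt Δs') hS ⟨(0, Δs), by simp [S]⟩ hε0 hε
    (fun z hz => ?_) hV (fun z => ENNReal.ofReal_ne_top) (b := ENNReal.ofReal b * c)
    (ENNReal.mul_ne_top ENNReal.ofReal_ne_top hc) N fun z => ?_
  · obtain ⟨x, Δ⟩ := z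
    obtain ⟨hx, rfl⟩ : |x| ≤ 1 ∧ Δ = Δs := hz
    exact hmin x hx
  obtain ⟨x, Δ⟩ := z
  have hΔ1 := one_le_of_mem_Dset hL' Δ.2
  have hint := integrable_abs_gaussianReal σ2
  have hΔ₁ := one_le_of_mem_Dset hL' (nxt (x, Δ) true).2
  have hΔ₀ := one_le_of_mem_Dset hL' (nxt (x, Δ) false).2
  have hE : 0 ≤ ∫ u, |u| ∂(gaussianReal 0 σ2) := integral_nonneg fun u => abs_nonneg u
  have hY : ∀ m {Δ' : ℝ}, 1 ≤ Δ' → 0 ≤ lyap (K / 2) C₁ C₂ η m Δ'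
      + C₂ / (K / 2 * Δ') * ∫ u, |u| ∂(gaussianReal 0 σ2) := fun m Δ' h =>
    add_nonneg (lyap_nonneg hC₁ hC₂ m h) (by positivity)
  have hstep : kernelOp P V (x, Δ) + 1 ≤ ENNReal.ofReal (lyap (K / 2) C₁ C₂ η x Δ
      + b * ({w : ℝ × ℝ | |w.1| ≤ M ∧ w.2 ≤ M'}.indicator 1 (x, (Δ : ℝ)))) := by
    refine le_trans ?_ (ENNReal.ofReal_le_ofReal
      (hdrift x Δ (nxt (x, Δ) true) (nxt (x, Δ) false) hΔ1 rfl rfl))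
    have hp1' : 0 ≤ 1 - p := by linarith
    rw [ENNReal.ofReal_add (add_nonneg (mul_nonneg hp0.le (hY _ hΔ₁)) (mul_nonneg hp1' (hY _ hΔ₀)))
      zero_le_one, ENNReal.ofReal_one, ← ofReal_mul_add_ofReal_mul hp0 hp1 (hY _ hΔ₁) (hY _ hΔ₀),
      kernelOp, hPeq, lintegral_add_measure, lintegral_smul_measure, lintegral_smul_measure,
      lintegral_map hV (by fun_prop), lintegral_map hV (by fun_prop), smul_eq_mul, smul_eq_mul]
    gcongr
    · exact lintegral_lyap_le hint hκ hC₁ hC₂ _ hΔ₁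
    · exact lintegral_lyap_le hint hκ hC₁ hC₂ _ hΔ₀
  refine hstep.trans (ENNReal.ofReal_add_le.trans ?_)
  gcongr
  by_cases hmem : |x| ≤ M ∧ (Δ : ℝ) ≤ M'
  · rw [Set.indicator_of_mem (show (x, (Δ : ℝ)) ∈ {w : ℝ × ℝ | |w.1| ≤ M ∧ w.2 ≤ M'} from hmem),
      Pi.one_apply, mul_one, mul_assoc]
    exact le_mul_of_one_le_right' (hN x Δ hmem.2 hmem.1)
  · rw [Set.indicator_of_notMem
      (show (x, (Δ : ℝ)) ∉ {w : ℝ × ℝ | |w.1| ≤ M ∧ w.2 ≤ M'} from hmem)]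
    simp
end
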